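/- Let M be a skew-symmetric n×n complex matrix. In the Clifford algebra Cl(Q) of ℂ^{2n} ≅ W ⊕ W^∨, set ξ := −Σ_{1≤i<j≤n} M_{ij} e_i e_j and g := exp(ξ). Then: (i) ξ = ψ(φ^{−1}(m_+)), where m_+ ∈ so(Q) is the endomorphism with block matrix [[0, −M],[0, 0]] in the basis (e_1,…,e_n, e_1^∨,…,e_n^∨), φ : Λ²ℂ^{2n} → so(Q) is the Lie algebra isomorphism determined by φ_{a∧b}(v) = 2(Q(b,v) a − Q(a,v) b), and ψ(a∧b) := ab − Q(a,b); (ii) g ∈ Spin(Q), with g* = g^{−1}; (iii) ρ(g) has block matrix [[I_n, −M],[0, I_n]], and in particular ρ(g) maps the isotropic subspace span(e_1^∨,…,e_n^∨) onto the row span of the n×2n block matrix [M | I_n]; (iv) Γ_g(1) = Σ_{J ⊆ [n], #J even} pf((−M)_J^J) e_J, i.e. for every even-size J ⊆ [n] the coefficient of σ(J) e_J in Γ_g(1) equals pf(M_J^J). -/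

import Mathlib

open scoped TensorProduct

noncomputable section

/-- The model `ℂ^{2n} ≅ W ⊕ W^∨`, where `W = ℂ^n`. -/
abbrev V (n : ℕ) := (Fin n → ℂ) × (Fin n → ℂ)

/-- The basis vector `e_i ∈ W`. -/
def eW (n : ℕ) (i : Fin n) : V n := (Pi.single i 1, 0)

/-- The dual basis vector `e_i^∨ ∈ W^∨`. -/
def eD (n : ℕ) (i : Fin n) : V n := (0, Pi.single i 1)

/-- The symmetric bilinear form `Q((x,x∨),(y,y∨)) = ½ (x∨(y) + y∨(x))` on `W ⊕ W^∨`. -/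
def Bform (n : ℕ) : V n →ₗ[ℂ] V n →ₗ[ℂ] ℂ :=
  LinearMap.mk₂ ℂ (fun x y => (1 / 2) * (∑ i, x.2 i * y.1 i + ∑ i, y.2 i * x.1 i))
    (by intro x x' y; simp [add_mul, mul_add, Finset.sum_add_distrib]; ring)
    (by intro c x y; simp [Finset.mul_sum, mul_add]
        congr 1 <;> exact Finset.sum_congr rfl fun _ _ => by ring)
    (by intro x y y'; simp [add_mul, mul_add, Finset.sum_add_distrib]; ring)
    (by intro x y y'; simp [Finset.mul_sum, mul_add]
        congr 1 <;> exact Finset.sum_congr rfl fun _ _ => by ring)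

/-- The quadratic form `x ↦ Q(x,x)` associated with `Q`. -/
def Qq (n : ℕ) : QuadraticForm ℂ (V n) := LinearMap.BilinMap.toQuadraticMap (Bform n)

/-- The Clifford algebra `Cl(Q)` of `(ℂ^{2n}, Q)`. -/
abbrev Cl (n : ℕ) := CliffordAlgebra (Qq n)

/-- Conjugation `u ↦ u*` on the Clifford algebra, with `(x₁⋯x_r)* = (−1)^r x_r⋯x₁`. -/
def conjC {n : ℕ} (x : Cl n) : Cl n :=
  CliffordAlgebra.reverse (CliffordAlgebra.involute x)

/-- Membership in the Pin group of `Q`. -/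
def PinG {n : ℕ} (x : Cl n) : Prop :=
  IsUnit x ∧ x * conjC x = 1 ∧
    ∀ v : V n, ∃ v' : V n,
      CliffordAlgebra.involute x * CliffordAlgebra.ι (Qq n) v * conjC x =
        CliffordAlgebra.ι (Qq n) v'

/-- Membership in the Spin group of `Q`. -/
def SpinG {n : ℕ} (x : Cl n) : Prop :=
  PinG x ∧ x ∈ CliffordAlgebra.evenOdd (Qq n) 0

/-- The reflection `R_w(v) = v − 2 (Q(v,w)/Q(w,w)) w`. -/
def reflV (n : ℕ) (w : V n) : V n →ₗ[ℂ] V n :=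
  LinearMap.id -
    (2 / Bform n w w) • ((LinearMap.toSpanSingleton ℂ (V n) w).comp ((Bform n).flip w))

/-- The half-spin representation space `S = Λ^• W`. -/
abbrev SS (n : ℕ) := ExteriorAlgebra ℂ (Fin n → ℂ)

/-- The linear map sending `a ∈ ℂ^n` to the corresponding dual functional
`w ↦ Σ aᵢ wᵢ` (the identification of `W^∨` with the dual of `W`). -/
def dualL (n : ℕ) : (Fin n → ℂ) →ₗ[ℂ] Module.Dual ℂ (Fin n → ℂ) :=
  ∑ i : Fin n, LinearMap.smulRight (LinearMap.proj i) (LinearMap.proj i)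

/-- The action of a vector `(a, a^∨) ∈ W ⊕ W^∨` on `S = Λ^• W`, by
`ω ↦ a ∧ ω + a^∨ ⌟ ω` (wedge plus interior product). -/
def gamGen (n : ℕ) : V n →ₗ[ℂ] Module.End ℂ (SS n) :=
  (LinearMap.mul ℂ (SS n)).comp ((ExteriorAlgebra.ι ℂ).comp (LinearMap.fst ℂ _ _)) +
    (CliffordAlgebra.contractLeft (Q := (0 : QuadraticForm ℂ (Fin n → ℂ)))).comp
      ((dualL n).comp (LinearMap.snd ℂ _ _))

theorem gamGen_sq (n : ℕ) (x : V n) :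
    gamGen n x * gamGen n x = algebraMap ℂ (Module.End ℂ (SS n)) (Qq n x) := by
  refine LinearMap.ext fun ω => ?_
  have key : ∀ (d : Module.Dual ℂ (Fin n → ℂ)) (a : Fin n → ℂ) (b : SS n),
      CliffordAlgebra.contractLeft (Q := (0 : QuadraticForm ℂ (Fin n → ℂ))) d
        (ExteriorAlgebra.ι ℂ a * b) =
        d a • b - ExteriorAlgebra.ι ℂ a *
          CliffordAlgebra.contractLeft (Q := (0 : QuadraticForm ℂ (Fin n → ℂ))) d b :=
    fun d a b => CliffordAlgebra.contractLeft_ι_mul _ _ _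
  simp only [Module.End.mul_apply, gamGen, LinearMap.add_apply, LinearMap.comp_apply,
    LinearMap.fst_apply, LinearMap.snd_apply, LinearMap.mul_apply']
  rw [mul_add, map_add, key]
  rw [CliffordAlgebra.contractLeft_contractLeft]
  have hsq : ExteriorAlgebra.ι ℂ x.1 * (ExteriorAlgebra.ι ℂ x.1 * ω) = 0 := by
    rw [← mul_assoc, ExteriorAlgebra.ι_sq_zero, zero_mul]
  rw [hsq]

  have hd : dualL n x.2 x.1 = Qq n x := by
    have h1 : Qq n x = Bform n x x := rfl
    rw [h1]
    simp [dualL, Bform]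
    ring
  rw [hd, Module.algebraMap_end_apply]
  abel

/-- The representation `Γ : Cl(Q) → End(S)` of the Clifford algebra on `S = Λ^• W`,
with a vector `(a, a^∨)` acting by wedging with `a` plus contraction by `a^∨`. -/
def Gamma (n : ℕ) : Cl n →ₐ[ℂ] Module.End ℂ (SS n) :=
  CliffordAlgebra.lift (Qq n) ⟨gamGen n, gamGen_sq n⟩

/-- The wedge monomial `e_J = e_{j₁} ∧ ⋯ ∧ e_{j_k} ∈ Λ^• W` for `J = {j₁ < ⋯ < j_k}`. -/
def eS {n : ℕ} (J : Finset (Fin n)) : SS n :=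
  ((J.sort (· ≤ ·)).map (fun i => ExteriorAlgebra.ι ℂ (Pi.single i 1))).prod

/-- The sign `σ(J)`: `−1` if `#J ≡ 2 (mod 4)` and `1` otherwise. -/
def sgn4 {n : ℕ} (J : Finset (Fin n)) : ℂ := if J.card % 4 = 2 then -1 else 1

open Matrix

/-- The Pfaffian of a skew-symmetric `N × N` complex matrix:
`pf(A) = (1/(2^m m!)) Σ_{σ ∈ S_N} sgn(σ) Π_{i=1}^{m} A_{σ(2i−1) σ(2i)}` where `N = 2m`;
it is `0` when `N` is odd (and `1` for the empty matrix). -/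
def pfaff {N : ℕ} (A : Matrix (Fin N) (Fin N) ℂ) : ℂ :=
  if h : N % 2 = 0 then
    ((2 : ℂ) ^ (N / 2) * ((N / 2).factorial : ℂ))⁻¹ *
      ∑ σ : Equiv.Perm (Fin N),
        ((Equiv.Perm.sign σ : ℤ) : ℂ) *
          ∏ i : Fin (N / 2),
            A (σ ⟨2 * i, by have := i.isLt; omega⟩) (σ ⟨2 * i + 1, by have := i.isLt; omega⟩)
  else 0

/-- The Pfaffian of the principal submatrix `A_I^I` of `A`, with rows and columns
indexed by `I` in increasing order. -/
def pfaffSub {N : ℕ} (A : Matrix (Fin N) (Fin N) ℂ) (I : Finset (Fin N)) : ℂ :=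
  pfaff (Matrix.of fun a b : Fin I.card =>
    A ((I.orderIsoOfFin rfl a : I) : Fin N) ((I.orderIsoOfFin rfl b : I) : Fin N))

section Sums

variable {ι G : Type*} [Fintype ι] [LinearOrder ι] [AddCommMonoid G]

theorem sum_sum_eq_sum_filter_lt (f : ι → ι → G) (hf : ∀ i, f i i = 0) :
    ∑ i, ∑ j, f i j =
      ∑ p ∈ Finset.univ.filter (fun p : ι × ι => p.1 < p.2), (f p.1 p.2 + f p.2 p.1) := by
  rw [← Fintype.sum_prod_type', Finset.sum_add_distrib,
    ← Finset.sum_filter_add_sum_filter_not _ (fun p : ι × ι => p.1 < p.2)]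
  congr 1
  have h : ∑ p ∈ Finset.univ.filter (fun p : ι × ι => p.1 < p.2), f p.2 p.1 =
      ∑ p ∈ Finset.univ.filter (fun p : ι × ι => p.2 < p.1), f p.1 p.2 :=
    Finset.sum_equiv (Equiv.prodComm ι ι) (by simp) (by simp)
  rw [h]
  refine (Finset.sum_subset (fun p hp => ?_) fun p hp hp' => ?_).symm
  · simpa using (by simpa using hp : p.2 < p.1).le
  · have : p.1 = p.2 := le_antisymm (by simpa using hp') (by simpa using hp)
    rw [this, hf]

end Sums

section TruncatedExp

variable {A : Type*} [Ring A] [Algebra ℂ A]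

theorem isNilpotent_exp_eq_sum_complex [Module ℚ A] {a : A} {k : ℕ} (h : a ^ k = 0) :
    IsNilpotent.exp a = ∑ i ∈ Finset.range k, ((i.factorial : ℂ))⁻¹ • a ^ i := by
  rw [IsNilpotent.exp_eq_sum h]
  refine Finset.sum_congr rfl fun i _ => ?_
  rw [← Rat.cast_smul_eq_qsmul ℂ]
  simp

theorem pow_succ_mul_of_commutator {ξ x y : A} (h : ξ * x = x * ξ + y) (hy : Commute ξ y) (k : ℕ) :
    ξ ^ (k + 1) * x = x * ξ ^ (k + 1) + ((k + 1 : ℕ) : ℂ) • (y * ξ ^ k) := by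
  induction k with
  | zero => simpa using h
  | succ k ih =>
    rw [pow_succ' ξ (k + 1), mul_assoc, ih, mul_add, ← mul_assoc, h, mul_smul_comm,
      ← mul_assoc ξ y, hy.eq, add_mul, mul_assoc y ξ, ← pow_succ', mul_assoc x ξ, add_assoc]
    congr 1
    push_cast
    module

theorem sum_pow_mul_of_commutator {ξ x y : A} {N : ℕ} (h : ξ * x = x * ξ + y) (hy : Commute ξ y)
    (hN : ξ ^ N = 0) :
    (∑ k ∈ Finset.range (N + 1), ((k.factorial : ℂ))⁻¹ • ξ ^ k) * x =
      (x + y) * ∑ k ∈ Finset.range (N + 1), ((k.factorial : ℂ))⁻¹ • ξ ^ k := by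
  have hlast : ∑ k ∈ Finset.range (N + 1), ((k.factorial : ℂ))⁻¹ • ξ ^ k =
      ∑ k ∈ Finset.range N, ((k.factorial : ℂ))⁻¹ • ξ ^ k := by
    rw [Finset.sum_range_succ, hN, smul_zero, add_zero]
  rw [add_mul]
  nth_rewrite 3 [hlast]
  rw [Finset.sum_range_succ', add_mul, mul_add, Finset.sum_mul, Finset.mul_sum, Finset.mul_sum]
  simp only [smul_mul_assoc, mul_smul_comm, pow_succ_mul_of_commutator h hy, smul_add,
    Finset.sum_add_distrib, pow_zero, one_mul, mul_one]
  have : ∀ k : ℕ, (((k + 1).factorial : ℂ))⁻¹ • ((k + 1 : ℕ) : ℂ) • (y * ξ ^ k) =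
      ((k.factorial : ℂ))⁻¹ • (y * ξ ^ k) := fun k => by
    rw [smul_smul, Nat.factorial_succ]
    congr 1
    push_cast
    have : (k : ℂ) + 1 ≠ 0 := by exact_mod_cast k.succ_ne_zero
    field_simp
  simp only [this]
  abel

end TruncatedExp

section Pfaffian

variable {n : ℕ}

theorem sum_smul_ι_mul_ι_pow (A : Matrix (Fin n) (Fin n) ℂ) (m : ℕ) :
    (∑ i, ∑ j, A i j • (ExteriorAlgebra.ι ℂ (Pi.single i 1 : Fin n → ℂ) *
        ExteriorAlgebra.ι ℂ (Pi.single j 1 : Fin n → ℂ))) ^ m =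
      ∑ f : Fin (2 * m) → Fin n,
        (∏ i : Fin m, A (f ⟨2 * i, by have := i.isLt; omega⟩)
          (f ⟨2 * i + 1, by have := i.isLt; omega⟩)) •
          ExteriorAlgebra.ιMulti ℂ (2 * m) (fun k => (Pi.single (f k) 1 : Fin n → ℂ)) := by
  induction m with
  | zero => simp
  | succ m ih =>
    rw [pow_succ', ih]
    have hcons : ∀ (k : ℕ) (F : (Fin (k + 1) → Fin n) → SS n),
        ∑ f, F f = ∑ i, ∑ f : Fin k → Fin n, F (Fin.cons i f) := fun k F => by
      rw [← Fintype.sum_prod_type']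
      exact (Fintype.sum_equiv (Fin.consEquiv fun _ => Fin n) _ _ fun _ => rfl).symm
    have hcons' : ∀ F : (Fin (2 * (m + 1)) → Fin n) → SS n,
        ∑ f, F f = ∑ i, ∑ f : Fin (2 * m + 1) → Fin n, F (Fin.cons i f) := hcons (2 * m + 1)
    rw [hcons']
    simp only [hcons (2 * m), Finset.sum_mul, Finset.mul_sum]
    refine Finset.sum_comm.trans (Finset.sum_congr rfl fun i _ => ?_)
    refine Finset.sum_comm.trans (Finset.sum_congr rfl fun j _ => Finset.sum_congr rfl fun f _ => ?_)
    have hι := (ExteriorAlgebra.ιMulti_succ_apply (R := ℂ) (n := 2 * m + 1) fun k =>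
      (Pi.single ((Fin.cons i (Fin.cons j f) : Fin (2 * m + 2) → Fin n) k) 1 : Fin n → ℂ)).trans
        (congrArg _ (ExteriorAlgebra.ιMulti_succ_apply _))
    rw [Fin.prod_univ_succ, smul_mul_smul_comm, mul_assoc]
    exact congrArg _ hι.symm

theorem pfaff_two_mul (m : ℕ) (A : Matrix (Fin (2 * m)) (Fin (2 * m)) ℂ) :
    pfaff A = ((2 : ℂ) ^ m * (m.factorial : ℂ))⁻¹ *
      ∑ σ : Equiv.Perm (Fin (2 * m)), ((Equiv.Perm.sign σ : ℤ) : ℂ) *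
        ∏ i : Fin m, A (σ ⟨2 * i, by have := i.isLt; omega⟩)
          (σ ⟨2 * i + 1, by have := i.isLt; omega⟩) := by
  have h : 2 * m / 2 = m := by omega
  rw [pfaff, dif_pos (by omega)]
  congr 1
  · rw [h]
  refine Finset.sum_congr rfl fun σ _ => ?_
  congr 1
  exact Fintype.prod_equiv (finCongr h) _ _ fun _ => rfl

theorem pfaffSub_eq {m : ℕ} (A : Matrix (Fin n) (Fin n) ℂ) (J : Finset (Fin n)) (h : J.card = m) :
    pfaffSub A J = pfaff (A.submatrix (J.orderEmbOfFin h) (J.orderEmbOfFin h)) := by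
  subst h
  rfl

theorem pfaffSub_neg (A : Matrix (Fin n) (Fin n) ℂ) (J : Finset (Fin n)) (hJ : Even J.card) :
    pfaffSub (-A) J = pfaffSub A J * sgn4 J := by
  obtain ⟨m, hm⟩ := hJ
  rw [← two_mul] at hm
  have hs : sgn4 J = (-1 : ℂ) ^ m := by
    rcases Nat.even_or_odd m with h | h
    · rw [h.neg_one_pow, sgn4, if_neg]
      obtain ⟨r, rfl⟩ := h
      omega
    · rw [h.neg_one_pow, sgn4, if_pos]
      obtain ⟨r, rfl⟩ := h
      omega
  rw [pfaffSub_eq _ J hm, pfaffSub_eq _ J hm, pfaff_two_mul, pfaff_two_mul, hs, mul_assoc,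
    Finset.sum_mul]
  congr 1
  refine Finset.sum_congr rfl fun σ _ => ?_
  simp only [Matrix.submatrix_apply, Matrix.neg_apply, Finset.prod_neg, Finset.card_univ,
    Fintype.card_fin]
  ring

theorem eS_eq_ιMulti {m : ℕ} (J : Finset (Fin n)) (h : J.card = m) :
    eS J = ExteriorAlgebra.ιMulti ℂ m
      (fun k => (Pi.single (J.orderEmbOfFin h k) 1 : Fin n → ℂ)) := by
  rw [eS, ExteriorAlgebra.ιMulti_apply, ← Finset.listMap_orderEmbOfFin_finRange J h, List.map_map,
    List.ofFn_eq_map]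
  rfl

theorem sum_image_eq_of_card {m : ℕ} {G : Type*} [AddCommMonoid G] (J : Finset (Fin n))
    (h : J.card = m) (F : (Fin m → Fin n) → G) :
    ∑ f with Finset.univ.image f = J, F f =
      ∑ σ : Equiv.Perm (Fin m), F (fun k => J.orderEmbOfFin h (σ k)) := by
  symm
  refine Finset.sum_bij (fun σ _ k => J.orderEmbOfFin h (σ k)) (fun σ _ => ?_)
    (fun σ _ τ _ hστ => ?_) (fun f hf => ?_) (fun _ _ => rfl)
  · simp only [Finset.mem_filter, Finset.mem_univ, true_and]
    have := Finset.image_orderEmbOfFin_univ J h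
    conv_rhs => rw [← this]
    ext x
    simp only [Finset.mem_image, Finset.mem_univ, true_and]
    exact (σ.surjective.exists (p := fun l => J.orderEmbOfFin h l = x)).symm
  · ext k
    exact congrArg _ ((J.orderEmbOfFin h).injective (congrFun hστ k))
  · simp only [Finset.mem_filter, Finset.mem_univ, true_and] at hf
    have hinj : Function.Injective f := by
      have := Finset.card_image_iff (s := Finset.univ) (f := f)
      rw [hf, h] at this
      simpa using this
    have hmem : ∀ k, ∃ l, J.orderEmbOfFin h l = f k := fun k => by
      have : f k ∈ Set.range (J.orderEmbOfFin h) := by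
        rw [Finset.range_orderEmbOfFin, ← hf]
        simp
      exact this
    choose s hs using hmem
    have hs_inj : Function.Injective s := fun a b hab => hinj (by rw [← hs, ← hs, hab])
    exact ⟨Equiv.ofBijective s (Finite.injective_iff_bijective.mp hs_inj), Finset.mem_univ _,
      funext hs⟩

theorem inv_factorial_smul_pow_eq_sum_pfaffSub (A : Matrix (Fin n) (Fin n) ℂ) (m : ℕ) :
    ((m.factorial : ℂ))⁻¹ • ((1 / 2 : ℂ) • ∑ i, ∑ j, A i j •
        (ExteriorAlgebra.ι ℂ (Pi.single i 1 : Fin n → ℂ) *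
          ExteriorAlgebra.ι ℂ (Pi.single j 1 : Fin n → ℂ))) ^ m =
      ∑ J : Finset (Fin n) with J.card = 2 * m, pfaffSub A J • eS J := by
  rw [smul_pow, sum_smul_ι_mul_ι_pow, smul_smul,
    ← Finset.sum_fiberwise_of_maps_to (s := Finset.univ) (t := Finset.univ)
      (g := fun f : Fin (2 * m) → Fin n => Finset.univ.image f) (fun _ _ => Finset.mem_univ _),
    Finset.smul_sum, Finset.sum_filter]
  refine Finset.sum_congr rfl fun J _ => ?_
  split_ifs with hJ
  · rw [sum_image_eq_of_card J hJ, pfaffSub_eq A J hJ, pfaff_two_mul, eS_eq_ιMulti J hJ,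
      mul_smul ((2 ^ m * (m.factorial : ℂ))⁻¹), Finset.sum_smul]
    congr 1
    · rw [mul_inv, mul_comm]
      simp
    · refine Finset.sum_congr rfl fun σ _ => ?_
      have := (ExteriorAlgebra.ιMulti ℂ (M := Fin n → ℂ) (2 * m)).map_perm
        (fun k => Pi.single (J.orderEmbOfFin hJ k) 1) σ
      simp only [Function.comp_def] at this
      rw [this, Units.smul_def, ← Int.cast_smul_eq_zsmul ℂ, smul_comm, smul_smul]
      rfl
  · rw [Finset.sum_eq_zero, smul_zero]
    intro f hf
    rw [AlternatingMap.map_eq_zero_of_not_injective, smul_zero]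
    intro hinj
    apply hJ
    have hf' : Finset.univ.image f = J := by simpa using hf
    rw [← hf', Finset.card_image_of_injective _ fun a b hab => hinj (by simp only [hab])]
    simp

theorem sum_smul_ι_mul_ι_pow_eq_zero (A : Matrix (Fin n) (Fin n) ℂ) {m : ℕ} (hm : n < 2 * m) :
    ((1 / 2 : ℂ) • ∑ i, ∑ j, A i j •
        (ExteriorAlgebra.ι ℂ (Pi.single i 1 : Fin n → ℂ) *
          ExteriorAlgebra.ι ℂ (Pi.single j 1 : Fin n → ℂ))) ^ m = 0 := by
  have h := inv_factorial_smul_pow_eq_sum_pfaffSub A m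
  rw [Finset.filter_false_of_mem, Finset.sum_empty] at h
  · exact (smul_eq_zero.mp h).resolve_left
      (inv_ne_zero (Nat.cast_ne_zero.mpr m.factorial_ne_zero))
  · intro J _
    have := J.card_le_univ
    rw [Fintype.card_fin] at this
    omega

theorem sum_pow_eq_sum_pfaffSub (A : Matrix (Fin n) (Fin n) ℂ) {N : ℕ} (hN : n < 2 * N) :
    ∑ m ∈ Finset.range N, ((m.factorial : ℂ))⁻¹ • ((1 / 2 : ℂ) • ∑ i, ∑ j, A i j •
        (ExteriorAlgebra.ι ℂ (Pi.single i 1 : Fin n → ℂ) *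
          ExteriorAlgebra.ι ℂ (Pi.single j 1 : Fin n → ℂ))) ^ m =
      ∑ J : Finset (Fin n) with Even J.card, pfaffSub A J • eS J := by
  simp only [inv_factorial_smul_pow_eq_sum_pfaffSub]
  rw [← Finset.sum_fiberwise_of_maps_to (t := Finset.range N)
    (g := fun J : Finset (Fin n) => J.card / 2)]
  · refine Finset.sum_congr rfl fun m _ => Finset.sum_congr ?_ fun _ _ => rfl
    ext J
    simp only [Finset.mem_filter, Finset.mem_univ, true_and, Nat.even_iff]
    omega
  · intro J _
    have := J.card_le_univ
    rw [Fintype.card_fin] at this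
    rw [Finset.mem_range]
    omega

end Pfaffian

section Clifford

open CliffordAlgebra

variable {n : ℕ}

theorem polar_Qq (x y : V n) : QuadraticMap.polar (Qq n) x y = 2 * Bform n x y := by
  have : Bform n y x = Bform n x y := by
    simp only [Bform, LinearMap.mk₂_apply]
    ring
  rw [Qq, LinearMap.BilinMap.polar_toQuadraticMap, this]
  ring

theorem ι_mul_ι_sub_mul_ι (a b x : V n) :
    (ι (Qq n) a * ι (Qq n) b - algebraMap ℂ (Cl n) (Bform n a b)) * ι (Qq n) x =
      ι (Qq n) x * (ι (Qq n) a * ι (Qq n) b - algebraMap ℂ (Cl n) (Bform n a b)) +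
        ι (Qq n) ((2 : ℂ) • (Bform n b x • a - Bform n a x • b)) := by
  have hb : ι (Qq n) b * ι (Qq n) x =
      (2 * Bform n b x) • (1 : Cl n) - ι (Qq n) x * ι (Qq n) b := by
    rw [← polar_Qq, ← Algebra.algebraMap_eq_smul_one, ← ι_mul_ι_add_swap]
    abel
  have ha : ι (Qq n) a * ι (Qq n) x =
      (2 * Bform n a x) • (1 : Cl n) - ι (Qq n) x * ι (Qq n) a := by
    rw [← polar_Qq, ← Algebra.algebraMap_eq_smul_one, ← ι_mul_ι_add_swap]
    abel
  rw [sub_mul, mul_sub, mul_assoc, hb, mul_sub, ← mul_assoc _ (ι (Qq n) x), ha,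
    Algebra.commutes (Bform n a b) (ι (Qq n) x)]
  simp only [map_smul, map_sub, sub_mul, mul_smul_comm, smul_mul_assoc, mul_one, one_mul,
    mul_assoc]
  module

theorem Bform_eW_eW (i j : Fin n) : Bform n (eW n i) (eW n j) = 0 := by
  simp [Bform, eW]

theorem Bform_eW_apply (i : Fin n) (x : V n) : Bform n (eW n i) x = 1 / 2 * x.2 i := by
  simp [Bform, eW, Pi.single_apply]

theorem Bform_prod_zero_skew {M : Matrix (Fin n) (Fin n) ℂ} (hM : Mᵀ = -M) (x y : V n) :
    Bform n (M *ᵥ x.2, 0) y + Bform n x (M *ᵥ y.2, 0) = 0 := by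
  have h : x.2 ⬝ᵥ M *ᵥ y.2 = -(y.2 ⬝ᵥ M *ᵥ x.2) := by
    rw [Matrix.dotProduct_mulVec, ← Matrix.mulVec_transpose, hM, dotProduct_comm,
      Matrix.neg_mulVec, dotProduct_neg]
  simp only [Bform, LinearMap.mk₂_apply, Pi.zero_apply, zero_mul, Finset.sum_const_zero, zero_add,
    add_zero, ← mul_add]
  simp only [dotProduct] at h
  rw [h]
  ring

theorem mulVec_eq_sum_filter_lt {M : Matrix (Fin n) (Fin n) ℂ} (hM : Mᵀ = -M) (x : V n) :
    ((-M *ᵥ x.2, 0) : V n) = ∑ p ∈ Finset.univ.filter (fun p : Fin n × Fin n => p.1 < p.2),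
      (2 : ℂ) • (Bform n (eW n p.2) x • (-M p.1 p.2 • eW n p.1) -
        Bform n (-M p.1 p.2 • eW n p.1) x • eW n p.2) := by
  have hskew : ∀ i j, M j i = -M i j := fun i j => congrFun (congrFun hM i) j
  have hdiag : ∀ i, M i i = 0 := fun i => self_eq_neg.mp (hskew i i)
  have h := sum_sum_eq_sum_filter_lt (fun i j => (-M i j * x.2 j) • eW n i)
    (fun i => by simp [hdiag])
  have h' : ((-M *ᵥ x.2, 0) : V n) = ∑ i, ∑ j, (-M i j * x.2 j) • eW n i := by
    simp only [← Finset.sum_smul]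
    ext k
    · simp [eW, Matrix.mulVec, dotProduct, Prod.fst_sum, Finset.sum_apply, Pi.single_apply]
    · simp [eW, Prod.snd_sum]
  rw [h', h]
  refine Finset.sum_congr rfl fun p _ => ?_
  simp only [map_smul, LinearMap.smul_apply, Bform_eW_apply, hskew p.1 p.2, smul_eq_mul]
  module

/-- The algebra homomorphism `Λ^• W → Cl(Q)` induced by the isotropic inclusion `W ⊆ W ⊕ W^∨`. -/
def exteriorToCl (n : ℕ) : SS n →ₐ[ℂ] Cl n :=
  ExteriorAlgebra.lift ℂ ⟨(ι (Qq n)).comp (LinearMap.inl ℂ (Fin n → ℂ) (Fin n → ℂ)), fun w => by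
    rw [LinearMap.comp_apply, ι_sq_scalar]
    have : Qq n (w, 0) = 0 := by
      change Bform n (w, 0) (w, 0) = 0
      simp [Bform]
    rw [LinearMap.inl_apply, this, map_zero]⟩

theorem exteriorToCl_ι_single (i : Fin n) :
    exteriorToCl n (ExteriorAlgebra.ι ℂ (Pi.single i 1)) = ι (Qq n) (eW n i) := by
  simp [exteriorToCl, eW]

theorem Gamma_exteriorToCl (ω η : SS n) : Gamma n (exteriorToCl n ω) η = ω * η := by
  have h : (Gamma n).comp (exteriorToCl n) = Algebra.lmul ℂ (SS n) := by
    refine ExteriorAlgebra.hom_ext (LinearMap.ext fun w => LinearMap.ext fun η => ?_)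
    simp [exteriorToCl, Gamma, gamGen]
  exact LinearMap.congr_fun (AlgHom.congr_fun h ω) η

theorem neg_sum_filter_lt_eq_exteriorToCl {M : Matrix (Fin n) (Fin n) ℂ} (hM : Mᵀ = -M) :
    -∑ p ∈ Finset.univ.filter (fun p : Fin n × Fin n => p.1 < p.2),
        M p.1 p.2 • (ι (Qq n) (eW n p.1) * ι (Qq n) (eW n p.2)) =
      exteriorToCl n ((1 / 2 : ℂ) • ∑ i, ∑ j, (-M) i j •
        (ExteriorAlgebra.ι ℂ (Pi.single i 1 : Fin n → ℂ) *
          ExteriorAlgebra.ι ℂ (Pi.single j 1 : Fin n → ℂ))) := by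
  have hskew : ∀ i j, M j i = -M i j := fun i j => congrFun (congrFun hM i) j
  have hdiag : ∀ i, M i i = 0 := fun i => self_eq_neg.mp (hskew i i)
  have hswap : ∀ i j, ι (Qq n) (eW n j) * ι (Qq n) (eW n i) =
      -(ι (Qq n) (eW n i) * ι (Qq n) (eW n j)) := fun i j => by
    rw [eq_neg_iff_add_eq_zero, ι_mul_ι_add_swap, polar_Qq, Bform_eW_eW, mul_zero, map_zero]
  simp only [map_smul, map_sum, map_mul, exteriorToCl_ι_single, Matrix.neg_apply]
  rw [sum_sum_eq_sum_filter_lt _ fun i => by simp [hdiag], Finset.smul_sum,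
    ← Finset.sum_neg_distrib]
  refine Finset.sum_congr rfl fun p _ => ?_
  rw [hskew p.1 p.2, hswap p.1 p.2]
  module

theorem reverse_pow (x : Cl n) (k : ℕ) : reverse (x ^ k) = reverse x ^ k := by
  induction k with
  | zero => simp
  | succ k ih => rw [pow_succ, reverse.map_mul, ih, pow_succ']

theorem conjC_ι_mul_ι_sub (a b : V n) :
    conjC (ι (Qq n) a * ι (Qq n) b - algebraMap ℂ (Cl n) (Bform n a b)) =
      -(ι (Qq n) a * ι (Qq n) b - algebraMap ℂ (Cl n) (Bform n a b)) := by
  have h := ι_mul_ι_add_swap (Q := Qq n) b a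
  have hs : Bform n b a = Bform n a b := by
    simp only [Bform, LinearMap.mk₂_apply]
    ring
  rw [polar_Qq, hs, two_mul, map_add] at h
  simp only [conjC, map_sub, map_mul, involute_ι, neg_mul_neg, reverse.map_mul, reverse_ι,
    AlgHom.commutes, reverse.commutes]
  rw [eq_sub_of_add_eq h]
  abel

end Clifford

theorem exp_clifford_element_spin (n : ℕ) (M : Matrix (Fin n) (Fin n) ℂ) (hM : Mᵀ = -M)
    (ξ : Cl n)
    (hξ : ξ = -∑ p ∈ Finset.univ.filter (fun p : Fin n × Fin n => p.1 < p.2),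
      M p.1 p.2 • (CliffordAlgebra.ι (Qq n) (eW n p.1) * CliffordAlgebra.ι (Qq n) (eW n p.2)))
    -- `g = exp(ξ)`, which here is the finite sum `Σ_{k ≤ 2n+1} ξ^k / k!` since `ξ` is
    -- nilpotent:
    (g : Cl n) (hg : g = ∑ k ∈ Finset.range (2 * n + 2), ((k.factorial : ℂ))⁻¹ • ξ ^ k)
    -- `m₊ ∈ so(Q)` is the endomorphism with block matrix `[[0, −M], [0, 0]]`:
    (mplus : V n →ₗ[ℂ] V n)
    (hmplus : mplus = LinearMap.prod
      (((-M).mulVecLin).comp (LinearMap.snd ℂ (Fin n → ℂ) (Fin n → ℂ))) 0) :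
    -- `m₊` is indeed in `so(Q)`:
    (∀ x y : V n, Bform n (mplus x) y + Bform n x (mplus y) = 0) ∧
    -- (i) `ξ = ψ(φ⁻¹(m₊))`: some 2-vector `Σ_t a_t ∧ b_t` maps to `m₊` under `φ` and
    -- to `ξ` under `ψ`:
    (∃ (m : ℕ) (a b : Fin m → V n),
      (∀ x : V n, mplus x =
        ∑ t : Fin m, (2 : ℂ) • ((Bform n (b t) x) • a t - (Bform n (a t) x) • b t)) ∧
      ξ = ∑ t : Fin m, (CliffordAlgebra.ι (Qq n) (a t) * CliffordAlgebra.ι (Qq n) (b t) -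
        algebraMap ℂ (Cl n) (Bform n (a t) (b t)))) ∧
    -- (ii) `g ∈ Spin(Q)` and `g* = g⁻¹`:
    SpinG g ∧ g * conjC g = 1 ∧ conjC g * g = 1 ∧
    -- (iii) `ρ(g)` has block matrix `[[Iₙ, −M], [0, Iₙ]]` …
    (∀ x : V n,
      CliffordAlgebra.involute g * CliffordAlgebra.ι (Qq n) x * conjC g =
        CliffordAlgebra.ι (Qq n)
          (LinearMap.prod
            (LinearMap.fst ℂ (Fin n → ℂ) (Fin n → ℂ) -
              (M.mulVecLin).comp (LinearMap.snd ℂ (Fin n → ℂ) (Fin n → ℂ)))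
            (LinearMap.snd ℂ (Fin n → ℂ) (Fin n → ℂ)) x)) ∧
    -- … and in particular maps `span(e₁^∨, …, eₙ^∨)` onto the row span of `[M | Iₙ]`:
    Submodule.map
        (LinearMap.prod
          (LinearMap.fst ℂ (Fin n → ℂ) (Fin n → ℂ) -
            (M.mulVecLin).comp (LinearMap.snd ℂ (Fin n → ℂ) (Fin n → ℂ)))
          (LinearMap.snd ℂ (Fin n → ℂ) (Fin n → ℂ)))
        (Submodule.span ℂ (Set.range (eD n))) =
      Submodule.span ℂ (Set.range fun i : Fin n => (((fun j => M i j), Pi.single i 1) : V n)) ∧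
    -- (iv) `Γ_g(1) = Σ_{J even} pf((−M)_J^J) e_J`, i.e. the coefficient of `σ(J) e_J`
    -- is `pf(M_J^J)`:
    Gamma n g 1 = (∑ J ∈ Finset.univ.filter (fun J : Finset (Fin n) => Even J.card),
      pfaffSub (-M) J • eS J) ∧
    Gamma n g 1 = (∑ J ∈ Finset.univ.filter (fun J : Finset (Fin n) => Even J.card),
      pfaffSub M J • (sgn4 J • eS J)) := by
  have hmplus' : ∀ x : V n, mplus x = (-M *ᵥ x.2, 0) := fun x => by
    subst hmplus
    rfl
  have hMneg : (-M)ᵀ = -(-M) := by rw [Matrix.transpose_neg, hM]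
  set S := Finset.univ.filter (fun p : Fin n × Fin n => p.1 < p.2)
  have hφ : ∀ x, mplus x = ∑ p ∈ S, (2 : ℂ) • (Bform n (eW n p.2) x • (-M p.1 p.2 • eW n p.1) -
      Bform n (-M p.1 p.2 • eW n p.1) x • eW n p.2) := fun x => by
    rw [hmplus', mulVec_eq_sum_filter_lt hM]
  have hψ : ξ = ∑ p ∈ S, (CliffordAlgebra.ι (Qq n) (-M p.1 p.2 • eW n p.1) *
      CliffordAlgebra.ι (Qq n) (eW n p.2) -
        algebraMap ℂ (Cl n) (Bform n (-M p.1 p.2 • eW n p.1) (eW n p.2))) := by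
    rw [hξ, ← Finset.sum_neg_distrib]
    refine Finset.sum_congr rfl fun p _ => ?_
    rw [map_smul (Bform n), LinearMap.smul_apply, Bform_eW_eW, smul_zero, map_zero, sub_zero,
      map_smul, smul_mul_assoc, neg_smul]
  have hext := hξ.trans (neg_sum_filter_lt_eq_exteriorToCl hM)
  have hpow : ∀ k, n < 2 * k → ξ ^ k = 0 := fun k hk => by
    rw [hext, ← map_pow, sum_smul_ι_mul_ι_pow_eq_zero _ hk, map_zero]
  have heven : ξ ∈ CliffordAlgebra.even (Qq n) := by
    rw [hψ]
    exact sum_mem fun p _ => sub_mem (CliffordAlgebra.ι_mul_ι_mem_evenOdd_zero _ _ _)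
      (Subalgebra.algebraMap_mem _ _)
  have hgeven : g ∈ CliffordAlgebra.even (Qq n) := by
    rw [hg]
    exact sum_mem fun k _ => Subalgebra.smul_mem _ (pow_mem heven k) _
  have hξinv : CliffordAlgebra.involute ξ = ξ := CliffordAlgebra.involute_eq_of_mem_even heven
  have hginv : CliffordAlgebra.involute g = g := CliffordAlgebra.involute_eq_of_mem_even hgeven
  have hξrev : CliffordAlgebra.reverse ξ = -ξ := by
    have h := congrArg conjC hψ
    rw [conjC, hξinv] at h
    rw [h]
    conv_rhs => rw [hψ, ← Finset.sum_neg_distrib]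
    simp only [← conjC_ι_mul_ι_sub, conjC, map_sum]
  have hnil : IsNilpotent ξ := ⟨2 * n + 2, hpow _ (by omega)⟩
  have hexp : g = IsNilpotent.exp ξ := by
    rw [hg, isNilpotent_exp_eq_sum_complex (hpow (2 * n + 2) (by omega))]
  have hconj : conjC g = IsNilpotent.exp (-ξ) := by
    have h0 : (-ξ) ^ (2 * n + 2) = 0 := by rw [neg_pow, hpow _ (by omega), mul_zero]
    rw [conjC, hginv, hg, isNilpotent_exp_eq_sum_complex h0]
    simp only [map_sum, map_smul, reverse_pow, hξrev]
  have hmul : g * conjC g = 1 := by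
    rw [hconj, hexp, IsNilpotent.exp_mul_exp_neg_self hnil]
  have hmul' : conjC g * g = 1 := by
    rw [hconj, hexp, IsNilpotent.exp_neg_mul_exp_self hnil]
  have hcomm : ∀ x, ξ * CliffordAlgebra.ι (Qq n) x =
      CliffordAlgebra.ι (Qq n) x * ξ + CliffordAlgebra.ι (Qq n) (mplus x) := fun x => by
    rw [hφ, hψ, Finset.sum_mul, Finset.mul_sum, map_sum, ← Finset.sum_add_distrib]
    exact Finset.sum_congr rfl fun p _ => ι_mul_ι_sub_mul_ι _ _ _
  have hρ : ∀ x : V n, CliffordAlgebra.involute g * CliffordAlgebra.ι (Qq n) x * conjC g =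
      CliffordAlgebra.ι (Qq n) (x + mplus x) := fun x => by
    have hc : Commute ξ (CliffordAlgebra.ι (Qq n) (mplus x)) := by
      have h0 : mplus (mplus x) = 0 := by simp [hmplus']
      have := hcomm (mplus x)
      rwa [h0, map_zero, add_zero] at this
    have := sum_pow_mul_of_commutator (hcomm x) hc (hpow (2 * n + 1) (by omega))
    rw [hginv, hg, this, ← hg, mul_assoc, hmul, mul_one, map_add]
  have hblock : ∀ x : V n, LinearMap.prod
      (LinearMap.fst ℂ (Fin n → ℂ) (Fin n → ℂ) -
        (M.mulVecLin).comp (LinearMap.snd ℂ (Fin n → ℂ) (Fin n → ℂ)))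
      (LinearMap.snd ℂ (Fin n → ℂ) (Fin n → ℂ)) x = x + mplus x := fun x => by
    rw [hmplus']
    ext k <;> simp [Matrix.neg_mulVec, sub_eq_add_neg]
  have hΓ : Gamma n g 1 = ∑ J ∈ Finset.univ.filter (fun J : Finset (Fin n) => Even J.card),
      pfaffSub (-M) J • eS J := by
    rw [← sum_pow_eq_sum_pfaffSub (-M) (N := 2 * n + 2) (by omega), hg, hext]
    simp only [← map_pow, ← map_smul, ← map_sum]
    rw [Gamma_exteriorToCl, mul_one]
  refine ⟨fun x y => ?_, ⟨S.card, fun t => -M (S.equivFin.symm t).1.1 (S.equivFin.symm t).1.2 •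
      eW n (S.equivFin.symm t).1.1, fun t => eW n (S.equivFin.symm t).1.2, fun x => ?_, ?_⟩,
    ⟨⟨⟨⟨g, conjC g, hmul, hmul'⟩, rfl⟩, hmul, fun v => ⟨_, hρ v⟩⟩, hgeven⟩, hmul, hmul',
    fun x => by rw [hρ, hblock], ?_, hΓ, ?_⟩
  · rw [hmplus', hmplus', Bform_prod_zero_skew hMneg]
  · rw [hφ, ← Finset.sum_coe_sort S]
    exact (Equiv.sum_comp S.equivFin.symm _).symm
  · rw [hψ, ← Finset.sum_coe_sort S]
    exact (Equiv.sum_comp S.equivFin.symm _).symm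
  · rw [Submodule.map_span, ← Set.range_comp]
    congr 2
    funext i
    rw [Function.comp_apply, hblock, hmplus']
    ext k
    · simpa [eD, Matrix.neg_mulVec] using (congrFun (congrFun hM k) i).symm
    · simp [eD]
  · rw [hΓ]
    refine Finset.sum_congr rfl fun J hJ => ?_
    rw [pfaffSub_neg M J (Finset.mem_filter.mp hJ).2, mul_smul]
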